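/- arXiv:1004.4438 — 2 statements merged into one kernel-verified Lean document; each statement's English description precedes it below -/
import Mathlib

section
/- Let k, d be integers with 1 ≤ k ≤ d, let M > 0 be real, and let i be an integer with 0 ≤ i ≤ k−1. Let γ be a real with f(i) ≤ γ and (i = 0 or γ < f(i−1)). Then for every integer j with 0 ≤ j ≤ k−1, (M − g(j)·γ)/(k−j) ≤ (M − g(i)·γ)/(k−i); that is, on the interval [f(i), f(i−1)) the piece (M − g(i)γ)/(k−i) is the maximum of the k linear cut-set lower bounds. -/
/-- The comparison of two cut-set bounds, cleared of denominators: the difference of the indices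
`y - x` factors out of both sides. -/
lemma cutset_piece_le_iff {k d M γ x y : ℝ} (hd : 0 < d) (hx : x < k) (hy : y < k) :
    (M - (2 * d - 2 * k + y + 1) * y / (2 * d) * γ) / (k - y) ≤
        (M - (2 * d - 2 * k + x + 1) * x / (2 * d) * γ) / (k - x) ↔
      (y - x) * (2 * M * d) ≤ (y - x) * (γ * (k * (2 * d - 2 * k + 1 + x + y) - x * y)) := by
  have hkx : 0 < k - x := sub_pos.2 hx
  have hky : 0 < k - y := sub_pos.2 hy
  rw [div_le_div_iff₀ hky hkx, ← mul_le_mul_iff_right₀ (show 0 < 2 * d by positivity),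
    ← sub_nonneg, ← sub_nonneg (a := (y - x) * (γ * _))]
  apply iff_of_eq
  congr 1
  field_simp
  ring

/-- The denominator of the breakpoint `f(x)` is positive. -/
lemma breakpoint_denom_pos {k d x : ℝ} (hk : 0 < k) (hkd : k ≤ d) (h0 : 0 ≤ x)
    (hx : x + 1 ≤ k) :
    0 < (2 * k - x - 1) * x + 2 * k * (d - k + 1) := by
  have h1 : 0 ≤ (2 * k - x - 1) * x := mul_nonneg (by linarith) h0
  have h2 : 0 < 2 * k * (d - k + 1) := mul_pos (by linarith) (by linarith)
  linarith


/-- On the interval `[f(i), f(i-1))` the piece `(M - g(i)γ)/(k-i)` dominates every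
other linear cut-set lower bound `(M - g(j)γ)/(k-j)`, `0 ≤ j ≤ k-1`. -/
theorem repair_piece_is_max (k d : ℕ) (hk : 1 ≤ k) (hkd : k ≤ d)
    (M : ℝ) (hM : 0 < M) (i : ℕ) (hi : i ≤ k - 1) (γ : ℝ)
    (f : ℕ → ℝ)
    (hf : ∀ j : ℕ, f j =
      2 * M * (d : ℝ) /
        ((2 * (k : ℝ) - (j : ℝ) - 1) * (j : ℝ) + 2 * (k : ℝ) * ((d : ℝ) - (k : ℝ) + 1)))
    (g : ℕ → ℝ)
    (hg : ∀ j : ℕ, g j =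
      (2 * (d : ℝ) - 2 * (k : ℝ) + (j : ℝ) + 1) * (j : ℝ) / (2 * (d : ℝ)))
    (h1 : f i ≤ γ) (h2 : i = 0 ∨ γ < f (i - 1)) :
    ∀ j : ℕ, j ≤ k - 1 →
      (M - g j * γ) / ((k : ℝ) - (j : ℝ)) ≤ (M - g i * γ) / ((k : ℝ) - (i : ℝ)) := by
  intro j hj
  have hk0 : (0 : ℝ) < k := by exact_mod_cast hk
  have hkd' : (k : ℝ) ≤ d := by exact_mod_cast hkd
  have hd0 : (0 : ℝ) < d := hk0.trans_le hkd'
  have hik : (i : ℝ) + 1 ≤ k := by exact_mod_cast (by omega : i + 1 ≤ k)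
  have hjk : (j : ℝ) + 1 ≤ k := by exact_mod_cast (by omega : j + 1 ≤ k)
  have hi0 : (0 : ℝ) ≤ i := i.cast_nonneg
  have hD := breakpoint_denom_pos hk0 hkd' hi0 hik
  rw [hf] at h1
  have hγ : 0 < γ := lt_of_lt_of_le (by positivity) h1
  rw [hg, hg, cutset_piece_le_iff hd0 (by linarith) (by linarith)]
  rcases lt_trichotomy i j with hij | rfl | hij
  · have hij' : (i : ℝ) + 1 ≤ j := by exact_mod_cast hij
    refine mul_le_mul_of_nonneg_left (((div_le_iff₀ hD).1 h1).trans ?_) (by linarith)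
    refine mul_le_mul_of_nonneg_left ?_ hγ.le
    nlinarith [mul_nonneg (sub_nonneg.2 hij') (by linarith : (0 : ℝ) ≤ k - i)]
  · simp
  · obtain ⟨m, rfl⟩ : ∃ m, i = m + 1 := ⟨i - 1, by omega⟩
    have h2 := h2.resolve_left m.succ_ne_zero
    rw [Nat.add_sub_cancel, hf] at h2
    push_cast at hik ⊢
    have hjm : (j : ℝ) ≤ m := by exact_mod_cast Nat.lt_succ_iff.1 hij
    have hDm := breakpoint_denom_pos hk0 hkd' m.cast_nonneg (by linarith : (m : ℝ) + 1 ≤ k)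
    refine mul_le_mul_of_nonpos_left (le_trans ?_ ((lt_div_iff₀ hDm).1 h2).le) (by linarith)
    refine mul_le_mul_of_nonneg_left ?_ hγ.le
    nlinarith [mul_nonneg (sub_nonneg.2 hjm) (by linarith : (0 : ℝ) ≤ k - (m + 1))]
end

section
/- Let n, k be integers with 1 ≤ k and k + 2 ≤ n, and let F be a finite field with |F| > 2·C(2n−1, 2k−1) (binomial coefficient). Let u_1, …, u_n, v_1, …, v_n ∈ F^{2k} be such that every 2k-element subfamily of the 2n vectors {u_1, …, u_n, v_1, …, v_n} is linearly independent (i.e., they form a (2n,2k)-MDS code). Then there exist scalars α_1, …, α_{k+1}, β_1, …, β_{k+1}, ρ_1, …, ρ_{k+1} ∈ F and a vector v'_n ∈ F^{2k} such that u_n = ∑_{i=1}^{k+1} (α_i u_i + β_i v_i), v'_n = ∑_{i=1}^{k+1} ρ_i (α_i u_i + β_i v_i), and every 2k-element subfamily of the 2n vectors {u_1, …, u_n, v_1, …, v_{n−1}, v'_n} is linearly independent. -/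
/-- The fibre of a linear map over `y` is not covered by few submodules, none of which contains it,
over a sufficiently large field. -/
theorem Submodule.exists_map_eq_forall_notMem_of_card_lt {K E V ι : Type*} [Field K]
    [AddCommGroup E] [Module K E] [AddCommGroup V] [Module K V] [Fintype ι]
    (A : E →ₗ[K] V) (y : V) (p : ι → Submodule K E) (hy : ∃ e, A e = y)
    (hp : ∀ i, ∃ e, A e = y ∧ e ∉ p i) (hcard : (Fintype.card ι + 1 : ℕ) < ENat.card K) :
    ∃ e, A e = y ∧ ∀ i, e ∉ p i := by
  let W : Submodule K (E × K) :=
    LinearMap.eqLocus (A ∘ₗ LinearMap.fst K E K) ((LinearMap.snd K E K).smulRight y)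
  let q : Option ι → Submodule K W := fun o =>
    o.elim (LinearMap.ker (LinearMap.snd K E K ∘ₗ W.subtype))
      fun i => (p i).comap (LinearMap.fst K E K ∘ₗ W.subtype)
  have hW : ∀ e, A e = y → (e, (1 : K)) ∈ W := fun e he => by simp [W, he]
  have hq : ∀ o, q o ≠ ⊤ := by
    rintro (_ | i) htop
    · obtain ⟨e, he⟩ := hy
      have : (⟨(e, 1), hW e he⟩ : W) ∈ q none := htop ▸ Submodule.mem_top
      simp [q] at this
    · obtain ⟨e, he, hei⟩ := hp i
      have : (⟨(e, 1), hW e he⟩ : W) ∈ q (some i) := htop ▸ Submodule.mem_top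
      exact hei (by simpa [q] using this)
  have hss := Submodule.iUnion_ssubset_of_forall_ne_top_of_card_lt Finset.univ q hq
    (by simpa [Fintype.card_option] using hcard)
  obtain ⟨⟨⟨e, c⟩, hec⟩, -, hnot⟩ := Set.exists_of_ssubset hss
  simp only [Finset.mem_univ, Set.iUnion_true, Set.mem_iUnion, SetLike.mem_coe, not_exists] at hnot
  have hc : c ≠ 0 := by simpa [q] using hnot none
  have hA : A e = c • y := by simpa [W] using hec
  refine ⟨c⁻¹ • e, by simp [hA, smul_smul, hc], fun i hi => hnot (some i) ?_⟩
  have : c • c⁻¹ • e ∈ p i := (p i).smul_mem c hi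
  simpa [q, smul_smul, hc] using this

/-- A linearly independent subfamily whose size is the dimension spans. -/
theorem LinearIndepOn.exists_sum_smul_eq {K V J : Type*} [Field K] [AddCommGroup V] [Module K V]
    [FiniteDimensional K V] {g : J → V} {s : Finset J} (hs : LinearIndepOn K g (s : Set J))
    (hcard : s.card = Module.finrank K V) (y : V) : ∃ c : J → K, ∑ j ∈ s, c j • g j = y := by
  have hspan : Submodule.span K (g '' (s : Set J)) = ⊤ := by
    have := LinearIndependent.span_eq_top_of_card_eq_finrank' hs (by simpa using hcard)
    rwa [Set.image_eq_range]
  have hy : y ∈ Submodule.span K (g '' (s : Set J)) := hspan ▸ Submodule.mem_top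
  exact (Submodule.mem_span_image_finset_iff_exists_fun' K).1 hy

/-- A family of `dim V + 2` vectors, arranged in pairs and such that every `dim V` of them are
independent, represents every vector with prescribed coefficients on one pair. -/
theorem exists_linearCombination_eq_of_forall_linearIndepOn {K V I : Type*} [Field K]
    [AddCommGroup V] [Module K V] [FiniteDimensional K V] [Fintype I] {f : I ⊕ I → V}
    (hf : ∀ S : Finset (I ⊕ I), S.card = Module.finrank K V → LinearIndepOn K f (S : Set (I ⊕ I)))
    (hI : 2 * Fintype.card I = Module.finrank K V + 2) (y : V) (i : I) (a b : K) :
    ∃ c : I ⊕ I → K, Fintype.linearCombination K f c = y ∧ c (.inl i) = a ∧ c (.inr i) = b := by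
  classical
  let S : Finset (I ⊕ I) := (Finset.univ.erase (.inl i)).erase (.inr i)
  have hS : S.card = Module.finrank K V := by
    rw [Finset.card_erase_of_mem (by simp), Finset.card_erase_of_mem (by simp)]
    simp only [Finset.card_univ, Fintype.card_sum]
    omega
  obtain ⟨c, hc⟩ := (hf S hS).exists_sum_smul_eq hS (y - a • f (.inl i) - b • f (.inr i))
  let c' := Function.update (Function.update c (.inl i) a) (.inr i) b
  have hcS : ∑ j ∈ S, c' j • f j = ∑ j ∈ S, c j • f j :=
    Finset.sum_congr rfl fun j hj => by
      simp only [S, Finset.mem_erase] at hj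
      simp [c', Function.update_of_ne hj.1, Function.update_of_ne hj.2.1]
  refine ⟨c', ?_, by simp [c'], by simp [c']⟩
  rw [Fintype.linearCombination_apply, ← Finset.add_sum_erase _ _ (Finset.mem_univ (.inl i)),
    ← Finset.add_sum_erase _ _ (show Sum.inr i ∈ Finset.univ.erase (Sum.inl i) by simp)]
  change _ + (_ + ∑ j ∈ S, _) = _
  rw [hcS, hc]
  simp [c']

/-- If every `dim V` members of a family `g` are independent, then `y` splits into a sum of vectors
taken from the planes spanned by pairs of members of `g`, so that some combination of these vectors
can replace `g a` without destroying the independence property. -/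
theorem exists_repair_of_forall_linearIndepOn {K V I J : Type*} [Field K] [AddCommGroup V]
    [Module K V] [FiniteDimensional K V] [Nontrivial V] [Fintype I] [Fintype J] [DecidableEq J]
    {g : J → V}
    (hg : ∀ S : Finset J, S.card = Module.finrank K V → LinearIndepOn K g (S : Set J))
    (h : I ⊕ I → J) (hh : Function.Injective h)
    (hI : 2 * Fintype.card I = Module.finrank K V + 2) (a : J) (y : V)
    (hK : ((Fintype.card J - 1).choose (Module.finrank K V - 1) + 1 : ℕ) < ENat.card K) :
    ∃ (c : I ⊕ I → K) (ρ : I → K),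
      ∑ i, (c (.inl i) • g (h (.inl i)) + c (.inr i) • g (h (.inr i))) = y ∧
      ∀ S : Finset J, S.card = Module.finrank K V →
        LinearIndepOn K (Function.update g a
          (∑ i, ρ i • (c (.inl i) • g (h (.inl i)) + c (.inr i) • g (h (.inr i)))))
          (S : Set J) := by
  classical
  set d := Module.finrank K V
  have hd0 : 0 < d := Module.finrank_pos
  let ι := (Finset.univ.erase a).powersetCard (d - 1)
  have hι : Fintype.card ι = (Fintype.card J - 1).choose (d - 1) := by
    rw [Fintype.card_coe, Finset.card_powersetCard, Finset.card_erase_of_mem (Finset.mem_univ a),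
      Finset.card_univ]
  let w : I → (I ⊕ I → K) →ₗ[K] V := fun i =>
    (LinearMap.proj (.inl i)).smulRight (g (h (.inl i))) +
      (LinearMap.proj (.inr i)).smulRight (g (h (.inr i)))
  have hf : ∀ S : Finset (I ⊕ I), S.card = d → LinearIndepOn K (g ∘ h) (S : Set (I ⊕ I)) := by
    intro S hS
    have := hg (S.map ⟨h, hh⟩) (by simpa using hS)
    rw [Finset.coe_map] at this
    exact this.comp_of_image hh.injOn
  have key (T : ι) : ∃ (i : I) (c : I ⊕ I → K), Fintype.linearCombination K (g ∘ h) c = y ∧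
      w i c ∉ Submodule.span K (g '' ((T : Finset J) : Set J)) := by
    have hT : (T : Finset J).card = d - 1 := (Finset.mem_powersetCard.1 T.2).2
    obtain ⟨_, hj, hjT⟩ : ∃ j ∈ Finset.univ.image h, j ∉ (T : Finset J) :=
      Finset.exists_mem_notMem_of_card_lt_card (by
        rw [Finset.card_image_of_injective _ hh, Finset.card_univ, Fintype.card_sum]; omega)
    obtain ⟨j, -, rfl⟩ := Finset.mem_image.1 hj
    have hspan : g (h j) ∉ Submodule.span K (g '' ((T : Finset J) : Set J)) := by
      have := hg (insert (h j) T) (by rw [Finset.card_insert_of_notMem hjT]; omega)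
      rw [Finset.coe_insert] at this
      exact this.notMem_span_of_insert hjT
    rcases j with i | i
    · obtain ⟨c, hc, ha, hb⟩ :=
        exists_linearCombination_eq_of_forall_linearIndepOn hf hI y i 1 0
      exact ⟨i, c, hc, by simpa [w, ha, hb] using hspan⟩
    · obtain ⟨c, hc, ha, hb⟩ :=
        exists_linearCombination_eq_of_forall_linearIndepOn hf hI y i 0 1
      exact ⟨i, c, hc, by simpa [w, ha, hb] using hspan⟩
  choose i hi using key
  have hy : ∃ c, Fintype.linearCombination K (g ∘ h) c = y := by
    have : 0 < Fintype.card I := by omega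
    obtain ⟨i₀⟩ := Fintype.card_pos_iff.1 this
    obtain ⟨c, hc, -⟩ := exists_linearCombination_eq_of_forall_linearIndepOn hf hI y i₀ 0 0
    exact ⟨c, hc⟩
  obtain ⟨c, hc, hcT⟩ := Submodule.exists_map_eq_forall_notMem_of_card_lt
    (Fintype.linearCombination K (g ∘ h)) y
    (fun T : ι => (Submodule.span K (g '' ((T : Finset J) : Set J))).comap (w (i T)))
    hy hi (by rwa [hι])
  obtain ⟨ρ, -, hρ⟩ := Submodule.exists_map_eq_forall_notMem_of_card_lt
    (0 : (I → K) →ₗ[K] V) 0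
    (fun T : ι => (Submodule.span K (g '' ((T : Finset J) : Set J))).comap
      (Fintype.linearCombination K fun i => w i c))
    ⟨0, rfl⟩ (fun T => ⟨Pi.single (i T) 1, rfl, by simpa using hcT T⟩) (by rwa [hι])
  refine ⟨c, ρ, ?_, fun S hS => ?_⟩
  · rw [← hc, Fintype.linearCombination_apply, Fintype.sum_sum_type, Finset.sum_add_distrib]
    rfl
  · have hcongr (T : Finset J) (hT : a ∉ T) (v : V) :
        Set.EqOn g (Function.update g a v) (T : Set J) := fun j hj => by
      rw [Function.update_of_ne (ne_of_mem_of_not_mem (Finset.mem_coe.1 hj) hT)]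
    by_cases haS : a ∈ S
    · have hnot := hcongr (S.erase a) (Finset.notMem_erase a S)
      rw [← Finset.insert_erase haS, Finset.coe_insert,
        linearIndepOn_insert (Finset.notMem_erase a S), ← linearIndepOn_congr (hnot _),
        ← (hnot _).image_eq, Function.update_self]
      refine ⟨(hg S hS).mono (by simp), ?_⟩
      exact hρ ⟨S.erase a, Finset.mem_powersetCard.2
        ⟨Finset.erase_subset_erase _ (Finset.subset_univ _),
          by rw [Finset.card_erase_of_mem haS, hS]⟩⟩
    · exact (hg S hS).congr (hcongr S haS _)


/-- Wu's repair theorem for systematic MDS codes: if the `2n` vectors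
`u₁,…,uₙ,v₁,…,vₙ ∈ F^{2k}` form a `(2n,2k)`-MDS code (every `2k` of them are linearly
independent) and `|F| > 2·C(2n-1, 2k-1)`, then when node `n` fails there are coefficients
`αᵢ, βᵢ, ρᵢ` (for the `k+1` helper nodes `1,…,k+1`) and a vector `v'ₙ` with
`uₙ = ∑ (αᵢ uᵢ + βᵢ vᵢ)`, `v'ₙ = ∑ ρᵢ (αᵢ uᵢ + βᵢ vᵢ)`, such that replacing `vₙ` by `v'ₙ`
keeps the `(2n,2k)`-MDS property. -/
theorem exists_repair_preserving_MDS (n k : ℕ) (hk : 1 ≤ k) (hn : k + 2 ≤ n)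
    (F : Type*) [Field F] [Fintype F]
    (hF : 2 * Nat.choose (2 * n - 1) (2 * k - 1) < Fintype.card F)
    (u v : Fin n → (Fin (2 * k) → F))
    (hMDS : ∀ S : Finset (Fin n ⊕ Fin n), S.card = 2 * k →
      LinearIndependent F (fun s : ↥S => Sum.elim u v (s : Fin n ⊕ Fin n))) :
    ∃ (a b ρ : Fin (k + 1) → F) (v' : Fin (2 * k) → F),
      u ⟨n - 1, by omega⟩ =
        ∑ i : Fin (k + 1),
          (a i • u ⟨i.1, by have := i.2; omega⟩ + b i • v ⟨i.1, by have := i.2; omega⟩) ∧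
      v' =
        ∑ i : Fin (k + 1),
          ρ i • (a i • u ⟨i.1, by have := i.2; omega⟩ + b i • v ⟨i.1, by have := i.2; omega⟩) ∧
      ∀ S : Finset (Fin n ⊕ Fin n), S.card = 2 * k →
        LinearIndependent F
          (fun s : ↥S =>
            Sum.elim u (Function.update v ⟨n - 1, by omega⟩ v') (s : Fin n ⊕ Fin n)) := by
  classical
  have hfin : Module.finrank F (Fin (2 * k) → F) = 2 * k := by simp
  have : NeZero (2 * k) := ⟨by omega⟩
  have : Nontrivial (Fin (2 * k) → F) := Module.nontrivial_of_finrank_pos (R := F) (by omega)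
  let e : Fin (k + 1) → Fin n := Fin.castLE (by omega)
  have he : Function.Injective e := Fin.castLE_injective _
  have hchoose : 0 < (2 * n - 1).choose (2 * k - 1) := Nat.choose_pos (by omega)
  obtain ⟨c, ρ, hsum, hind⟩ := exists_repair_of_forall_linearIndepOn (K := F)
    (g := Sum.elim u v) (fun S hS => hMDS S (hS.trans hfin)) (Sum.map e e)
    (Sum.map_injective.2 ⟨he, he⟩) (by rw [hfin, Fintype.card_fin]; ring)
    (.inr ⟨n - 1, by omega⟩) (u ⟨n - 1, by omega⟩) (by
      rw [hfin, Fintype.card_sum, Fintype.card_fin, ← two_mul, ENat.card_eq_coe_fintype_card]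
      exact_mod_cast (by omega))
  refine ⟨c ∘ .inl, c ∘ .inr, ρ, _, hsum.symm, rfl, fun S hS => ?_⟩
  rw [← Sum.update_elim_inr]
  exact hind S (hS.trans hfin.symm)
end
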